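/- arXiv:2312.15935 — 2 statements merged into one kernel-verified Lean document; each statement's English description precedes it below -/
import Mathlib

section
/- Approximation by steppings: let W be a signed measure-valued kernel and let (𝒫_n)_{n∈ℕ} be a sequence of finite measurable partitions of [0,1] such that 𝒫_{n+1} refines 𝒫_n for every n and the collection of sets {S : S ∈ 𝒫_n, n ∈ ℕ} generates the Borel σ-field of [0,1]. Then the steppings W_{𝒫_n} satisfy ‖W_{𝒫_n}‖∞ ≤ ‖W‖∞ for all n, and for Lebesgue-a.e. (x,y) ∈ [0,1]², W_{𝒫_n}(x,y;·) converges weakly to W(x,y;·) as n → ∞. -/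
open MeasureTheory Filter Topology
open scoped ENNReal NNReal

noncomputable section

namespace PG

/-- The unit square `[0,1]²`, with its product Lebesgue measure. -/
abbrev Sq : Type := unitInterval × unitInterval

variable {Z : Type*} [MeasurableSpace Z] [TopologicalSpace Z]

/-! ### Measure-valued kernels and probability-graphons -/

/-- `W(A;·) = ∫_A W(x,y;·) dx dy` for a measure-valued kernel. -/
def kernelInt (W : Sq → Measure Z) (A : Set Sq) : Measure Z :=
  ((volume : Measure Sq).restrict A).bind W

/-- The measure `M_W = W([0,1]²;·)` associated with a (positive) measure-valued kernel. -/
def MW (W : Sq → Measure Z) : Measure Z := (volume : Measure Sq).bind W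

/-- A probability-graphon: a measurable map from `[0,1]²` to probability measures on `Z`. -/
def IsProbGraphon (W : Sq → Measure Z) : Prop :=
  (∀ A : Set Z, MeasurableSet A → Measurable fun p => W p A) ∧
    ∀ p, IsProbabilityMeasure (W p)

/-- Essential supremum of the total mass of a positive measure-valued kernel. -/
def TVboundPos (W : Sq → Measure Z) : ℝ≥0∞ :=
  essSup (fun p => W p Set.univ) (volume : Measure Sq)

/-- A (positive) measure-valued kernel: measurable and essentially bounded. -/
def IsPosKernel (W : Sq → Measure Z) : Prop :=
  (∀ A : Set Z, MeasurableSet A → Measurable fun p => W p A) ∧ TVboundPos W < ⊤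

/-- Relabeling `W^φ` of a kernel by a map `φ : [0,1] → [0,1]`. -/
def relabel (W : Sq → Measure Z) (φ : unitInterval → unitInterval) : Sq → Measure Z :=
  fun p => W (φ p.1, φ p.2)

/-- `φ` is a Lebesgue-measure-preserving map of `[0,1]`. -/
def IsMP (φ : unitInterval → unitInterval) : Prop :=
  MeasurePreserving φ (volume : Measure unitInterval) (volume : Measure unitInterval)

/-- Weak convergence of a sequence of (finite) measures on `Z`. -/
def WeakTendsto (μ : ℕ → Measure Z) (ν : Measure Z) : Prop :=
  ∀ f : BoundedContinuousFunction Z ℝ,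
    Tendsto (fun n => ∫ x, f x ∂(μ n)) atTop (𝓝 (∫ x, f x ∂ν))

/-- The cut distance `d_{□,m}` associated with a distance `d_m` on measures. -/
def cutDist (dm : Measure Z → Measure Z → ℝ) (U W : Sq → Measure Z) : ℝ :=
  ⨆ ST : {p : Set unitInterval × Set unitInterval // MeasurableSet p.1 ∧ MeasurableSet p.2},
    dm (kernelInt U (ST.val.1 ×ˢ ST.val.2)) (kernelInt W (ST.val.1 ×ˢ ST.val.2))

/-- The unlabeled cut distance `δ_□` associated with a distance `d` on kernels:
`δ_□(U,W) = inf_{φ ∈ S_{[0,1]}} d(U, W^φ)`. -/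
def deltaCut (d : (Sq → Measure Z) → (Sq → Measure Z) → ℝ) (U W : Sq → Measure Z) : ℝ :=
  ⨅ φ : {φ : unitInterval → unitInterval // IsMP φ ∧ Function.Bijective φ},
    d U (relabel W φ.val)

/-- Weak isomorphism of kernels: `U^φ = W^ψ` a.e. for some measure-preserving `φ, ψ`. -/
def WeakIso (U W : Sq → Measure Z) : Prop :=
  ∃ φ ψ : unitInterval → unitInterval, IsMP φ ∧ IsMP ψ ∧
    relabel U φ =ᵐ[(volume : Measure Sq)] relabel W ψ

/-- A family of kernels is tight if the family of measures `{M_W}` is tight. -/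
def TightFamily (K : Set (Sq → Measure Z)) : Prop :=
  ∀ ε : ℝ≥0∞, 0 < ε → ∃ K₀ : Set Z, IsCompact K₀ ∧ ∀ W ∈ K, MW W K₀ᶜ ≤ ε

/-- Invariance of a distance on probability-graphons under bijective
measure-preserving relabelings. -/
def Invariant (d : (Sq → Measure Z) → (Sq → Measure Z) → ℝ) : Prop :=
  ∀ U W : Sq → Measure Z, IsProbGraphon U → IsProbGraphon W →
    ∀ φ : unitInterval → unitInterval, IsMP φ → Function.Bijective φ →
      d (relabel U φ) (relabel W φ) = d U W

/-- Smoothness of a distance on probability-graphons: a.e. weak convergence implies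
convergence in `d`. -/
def Smooth (d : (Sq → Measure Z) → (Sq → Measure Z) → ℝ) : Prop :=
  ∀ (Wn : ℕ → Sq → Measure Z) (W : Sq → Measure Z),
    (∀ n, IsProbGraphon (Wn n)) → IsProbGraphon W →
    (∀ᵐ p ∂(volume : Measure Sq), WeakTendsto (fun n => Wn n p) (W p)) →
    Tendsto (fun n => d (Wn n) W) atTop (𝓝 0)

/-- `d` is a distance on the space `𝒲₁` of probability-graphons (where kernels that
agree a.e. are identified). -/
def IsGraphonDist (d : (Sq → Measure Z) → (Sq → Measure Z) → ℝ) : Prop :=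
  (∀ U W, IsProbGraphon U → IsProbGraphon W → d U W = d W U) ∧
  (∀ U W, IsProbGraphon U → IsProbGraphon W → 0 ≤ d U W) ∧
  (∀ U V W, IsProbGraphon U → IsProbGraphon V → IsProbGraphon W → d U W ≤ d U V + d V W) ∧
  (∀ U W, IsProbGraphon U → IsProbGraphon W →
    (d U W = 0 ↔ U =ᵐ[(volume : Measure Sq)] W))

/-- Distance axioms for `d` on a subset `M`. -/
def IsDistOnSet {α : Type*} (M : Set α) (d : α → α → ℝ) : Prop :=
  (∀ x ∈ M, ∀ y ∈ M, d x y = d y x) ∧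
  (∀ x ∈ M, ∀ y ∈ M, 0 ≤ d x y) ∧
  (∀ x ∈ M, ∀ y ∈ M, ∀ z ∈ M, d x z ≤ d x y + d y z) ∧
  (∀ x ∈ M, ∀ y ∈ M, (d x y = 0 ↔ x = y))

/-- The set `ℳ≤1(Z)` of measures of total mass at most one. -/
def SubProb (Z : Type*) [MeasurableSpace Z] : Set (Measure Z) := {μ | μ Set.univ ≤ 1}

/-- `d_m` is a distance on `ℳ≤1(Z)`. -/
def IsDistOnSubProb (dm : Measure Z → Measure Z → ℝ) : Prop :=
  IsDistOnSet (SubProb Z) dm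

/-- `d_m` induces the weak topology on `ℳ≤1(Z)` (sequential formulation; the weak
topology on `ℳ≤1(Z)` is metrizable, so it is characterized by its convergent
sequences). -/
def InducesWeakTopologySub (dm : Measure Z → Measure Z → ℝ) : Prop :=
  ∀ (μn : ℕ → Measure Z) (μ : Measure Z), (∀ n, μn n ∈ SubProb Z) → μ ∈ SubProb Z →
    (Tendsto (fun n => dm (μn n) μ) atTop (𝓝 0) ↔ WeakTendsto μn μ)

/-- Quasi-convexity of a distance on the convex set `ℳ₊(Z)` of finite measures. -/
def QuasiConvexPos (dm : Measure Z → Measure Z → ℝ) : Prop :=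
  ∀ μ₁ μ₂ ν₁ ν₂ : Measure Z, IsFiniteMeasure μ₁ → IsFiniteMeasure μ₂ →
    IsFiniteMeasure ν₁ → IsFiniteMeasure ν₂ → ∀ a : ℝ≥0∞, a ≤ 1 →
    dm (a • μ₁ + (1 - a) • μ₂) (a • ν₁ + (1 - a) • ν₂) ≤ max (dm μ₁ ν₁) (dm μ₂ ν₂)

/-! ### Finite partitions of `[0,1]` and the stepping operator -/

/-- A finite measurable partition of `[0,1]` (possibly with empty classes). -/
structure FinPartition : Type where
  n : ℕ
  part : Fin n → Set unitInterval
  measurableSet : ∀ i, MeasurableSet (part i)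
  disjoint : ∀ i j, i ≠ j → Disjoint (part i) (part j)
  covers : (⋃ i, part i) = Set.univ

/-- `P` refines `Q`: every class of `P` is included in a class of `Q`. -/
def FinPartition.Refines (P Q : FinPartition) : Prop :=
  ∀ i, ∃ j, P.part i ⊆ Q.part j

/-- The stepping `W_𝒫` of a (positive) measure-valued kernel `W` with respect to a
finite partition `𝒫`: on `S_i × S_j` it equals `W(S_i×S_j;·)/(λ(S_i)λ(S_j))`
(and the zero measure on classes of zero measure). -/
def stepping (W : Sq → Measure Z) (P : FinPartition) : Sq → Measure Z :=
  fun p => ∑ i : Fin P.n, ∑ j : Fin P.n,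
    Set.indicator (P.part i ×ˢ P.part j)
      (fun _ => ((volume (P.part i)) * (volume (P.part j)))⁻¹ •
        kernelInt W (P.part i ×ˢ P.part j)) p

/-- Weak regularity of a distance on probability-graphons. -/
def WeaklyRegular (d : (Sq → Measure Z) → (Sq → Measure Z) → ℝ) : Prop :=
  ∀ K : Set (Sq → Measure Z), (∀ W ∈ K, IsProbGraphon W) → TightFamily K →
    ∀ ε : ℝ, 0 < ε → ∃ m : ℕ, 0 < m ∧
      ∀ W ∈ K, ∀ Q : FinPartition, ∃ P : FinPartition,
        P.Refines Q ∧ P.n ≤ m * Q.n ∧ d W (stepping W P) < ε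

/-- Regularity of a distance on probability-graphons with respect to the stepping
operator. -/
def SteppingRegular (d : (Sq → Measure Z) → (Sq → Measure Z) → ℝ) : Prop :=
  ∃ C₀ : ℝ, 0 < C₀ ∧ ∀ W U : Sq → Measure Z, IsProbGraphon W → IsProbGraphon U →
    ∀ P : FinPartition, d W (stepping W P) ≤ C₀ * d W (stepping U P)

/-! ### Signed measure-valued kernels -/

/-- The signed measure associated with a finite measure (and junk value `0` on
non-finite measures). -/
def toSigned (μ : Measure Z) : SignedMeasure Z :=
  letI := Classical.dec (IsFiniteMeasure μ)
  if h : IsFiniteMeasure μ then @Measure.toSignedMeasure Z _ μ h else 0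

/-- `W(A;·)` for a signed measure-valued kernel. -/
def skernelInt (W : Sq → SignedMeasure Z) (A : Set Sq) : SignedMeasure Z :=
  toSigned (((volume : Measure Sq).restrict A).bind
      fun p => (W p).toJordanDecomposition.posPart)
    - toSigned (((volume : Measure Sq).restrict A).bind
      fun p => (W p).toJordanDecomposition.negPart)

/-- Total mass `‖s‖_TV` of the total variation of a signed measure. -/
def TVnorm (s : SignedMeasure Z) : ℝ≥0∞ := s.totalVariation Set.univ

/-- `‖W‖∞`, the essential supremum of the total variation masses of a signed
measure-valued kernel. -/
def TVbound (W : Sq → SignedMeasure Z) : ℝ≥0∞ :=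
  essSup (fun p => TVnorm (W p)) (volume : Measure Sq)

/-- A signed measure-valued kernel: measurable in `(x,y)` and essentially bounded in
total variation. -/
def IsSignedKernel (W : Sq → SignedMeasure Z) : Prop :=
  (∀ A : Set Z, MeasurableSet A → Measurable fun p => W p A) ∧ TVbound W < ⊤

/-- The measure `M_W = ∫ |W|(x,y;·) dx dy` of a signed measure-valued kernel. -/
def MWs (W : Sq → SignedMeasure Z) : Measure Z :=
  (volume : Measure Sq).bind fun p => (W p).totalVariation

/-- Tightness for a family of signed measure-valued kernels. -/
def TightFamilyS (K : Set (Sq → SignedMeasure Z)) : Prop :=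
  ∀ ε : ℝ≥0∞, 0 < ε → ∃ K₀ : Set Z, IsCompact K₀ ∧ ∀ W ∈ K, MWs W K₀ᶜ ≤ ε

/-- Integral of a bounded continuous function against a signed measure. -/
def sint (f : BoundedContinuousFunction Z ℝ) (s : SignedMeasure Z) : ℝ :=
  ∫ x, f x ∂s.toJordanDecomposition.posPart - ∫ x, f x ∂s.toJordanDecomposition.negPart

/-- Weak convergence of signed measures. -/
def WeakTendstoS (s : ℕ → SignedMeasure Z) (t : SignedMeasure Z) : Prop :=
  ∀ f : BoundedContinuousFunction Z ℝ,
    Tendsto (fun n => sint f (s n)) atTop (𝓝 (sint f t))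

/-- Stepping of a signed measure-valued kernel with respect to a finite partition. -/
def steppingS (W : Sq → SignedMeasure Z) (P : FinPartition) : Sq → SignedMeasure Z :=
  fun p => ∑ i : Fin P.n, ∑ j : Fin P.n,
    Set.indicator (P.part i ×ˢ P.part j)
      (fun _ => (((volume (P.part i)).toReal * (volume (P.part j)).toReal)⁻¹ : ℝ) •
        skernelInt W (P.part i ×ˢ P.part j)) p

/-- Cut distance for signed measure-valued kernels associated with a distance `d_m`
on signed measures. -/
def cutDistS (dm : SignedMeasure Z → SignedMeasure Z → ℝ) (U W : Sq → SignedMeasure Z) : ℝ :=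
  ⨆ ST : {p : Set unitInterval × Set unitInterval // MeasurableSet p.1 ∧ MeasurableSet p.2},
    dm (skernelInt U (ST.val.1 ×ˢ ST.val.2)) (skernelInt W (ST.val.1 ×ˢ ST.val.2))

/-- Quasi-convexity of a distance on a convex subset `M` of signed measures. -/
def QuasiConvexOn (M : Set (SignedMeasure Z)) (dm : SignedMeasure Z → SignedMeasure Z → ℝ) :
    Prop :=
  ∀ x₁ ∈ M, ∀ x₂ ∈ M, ∀ y₁ ∈ M, ∀ y₂ ∈ M, ∀ a : ℝ, 0 ≤ a → a ≤ 1 →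
    dm (a • x₁ + (1 - a) • x₂) (a • y₁ + (1 - a) • y₂) ≤ max (dm x₁ y₁) (dm x₂ y₂)

/-! ### Convergence determining sequences and the associated norms -/

/-- `F` is a convergence determining sequence: `[0,1]`-valued bounded continuous
functions, `F 0 = 1`, such that convergence of all moments `μ(f_k)` implies weak
convergence (for finite positive measures). -/
def IsConvDet (F : ℕ → BoundedContinuousFunction Z ℝ) : Prop :=
  F 0 = 1 ∧ (∀ k x, F k x ∈ Set.Icc (0:ℝ) 1) ∧
  ∀ (μn : ℕ → Measure Z) (μ : Measure Z), (∀ n, IsFiniteMeasure (μn n)) → IsFiniteMeasure μ →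
    (∀ k, Tendsto (fun n => ∫ x, F k x ∂(μn n)) atTop (𝓝 (∫ x, F k x ∂μ))) →
    WeakTendsto μn μ

/-- `‖μ − ν‖_F = Σ_k 2^{-k} |μ(f_k) − ν(f_k)|` for positive measures. -/
def Fdist (F : ℕ → BoundedContinuousFunction Z ℝ) (μ ν : Measure Z) : ℝ :=
  ∑' k : ℕ, (1/2 : ℝ) ^ k * |∫ x, F k x ∂μ - ∫ x, F k x ∂ν|

/-- The cut distance `d_{□,F}(U,W) = ‖U − W‖_{□,F}` on measure-valued kernels. -/
def cutDistF (F : ℕ → BoundedContinuousFunction Z ℝ) (U W : Sq → Measure Z) : ℝ :=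
  ⨆ ST : {p : Set unitInterval × Set unitInterval // MeasurableSet p.1 ∧ MeasurableSet p.2},
    Fdist F (kernelInt U (ST.val.1 ×ˢ ST.val.2)) (kernelInt W (ST.val.1 ×ˢ ST.val.2))

/-- The norm `‖s‖_F` of a signed measure. -/
def FnormS (F : ℕ → BoundedContinuousFunction Z ℝ) (s : SignedMeasure Z) : ℝ :=
  ∑' k : ℕ, (1/2 : ℝ) ^ k * |sint (F k) s|

/-- The cut norm `‖W‖_{□,F}` of a signed measure-valued kernel. -/
def cutNormFS (F : ℕ → BoundedContinuousFunction Z ℝ) (W : Sq → SignedMeasure Z) : ℝ :=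
  ⨆ ST : {p : Set unitInterval × Set unitInterval // MeasurableSet p.1 ∧ MeasurableSet p.2},
    FnormS F (skernelInt W (ST.val.1 ×ˢ ST.val.2))

/-- The norm `‖W‖_{2,F}` of a signed measure-valued kernel. -/
def norm2F (F : ℕ → BoundedContinuousFunction Z ℝ) (W : Sq → SignedMeasure Z) : ℝ :=
  Real.sqrt (∑' k : ℕ, (1/2 : ℝ) ^ k * ∫ p, (sint (F k) (W p)) ^ 2 ∂(volume : Measure Sq))

/-! ### Homomorphism densities and sampling -/

/-- The homomorphism density `t(F^g, W)` of a `C_b(Z)`-decorated finite directed graph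
with vertex set `Fin v` and edge set `E` in a measure-valued kernel `W`. -/
def homDensity {v : ℕ} (E : Finset (Fin v × Fin v))
    (g : Fin v × Fin v → BoundedContinuousFunction Z ℝ) (W : Sq → Measure Z) : ℝ :=
  ∫ x : Fin v → unitInterval,
    (∏ e ∈ E, ∫ z, g e z ∂(W (x e.1, x e.2))) ∂(volume : Measure (Fin v → unitInterval))

/-- The edge set of the complete directed graph on `k` vertices. -/
def completeEdges (k : ℕ) : Finset (Fin k × Fin k) :=
  Finset.univ.filter fun e => e.1 ≠ e.2

/-- The `i`-th step `((i)/k, (i+1)/k]` of the uniform partition of `[0,1]` into `k`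
intervals. -/
def stepSet (k : ℕ) (i : Fin k) : Set unitInterval :=
  {t | (i : ℝ) / k < (t : ℝ) ∧ (t : ℝ) ≤ ((i : ℝ) + 1) / k}

/-- The stepfunction `W_x` sampled from `W` at the points `x = (x₁, …, x_k)`. -/
def sample (W : Sq → Measure Z) {k : ℕ} (x : Fin k → unitInterval) : Sq → Measure Z :=
  fun p => ∑ i : Fin k, ∑ j : Fin k,
    Set.indicator (stepSet k i ×ˢ stepSet k j) (fun _ => W (x i, x j)) p

/-- The probability-graphon associated with the `Z`-weighted complete graph on `k`
vertices with weights `β`. -/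
def graphonOfWeights {k : ℕ} (β : Fin k × Fin k → Z) : Sq → Measure Z :=
  fun p => ∑ i : Fin k, ∑ j : Fin k,
    Set.indicator (stepSet k i ×ˢ stepSet k j) (fun _ => Measure.dirac (β (i, j))) p

/-- The joint law of `(X, (β_{ij}))` where `X` is uniform on `[0,1]^k` and, given `X`,
the weights `β_{ij}` are independent with respective laws `W(X_i, X_j;·)`. -/
def sampleLaw (W : Sq → Measure Z) (k : ℕ) :
    Measure ((Fin k → unitInterval) × (Fin k × Fin k → Z)) :=
  (volume : Measure (Fin k → unitInterval)).bind fun x =>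
    (Measure.pi fun e : Fin k × Fin k => W (x e.1, x e.2)).map (Prod.mk x)


theorem condExp_comap_ae_eq_setAverage {Ω κ : Type*} [MeasurableSpace Ω] [Fintype κ]
    [mκ : MeasurableSpace κ] [MeasurableSingletonClass κ] {μ : Measure Ω} [IsFiniteMeasure μ]
    {ι : Ω → κ} (hι : Measurable ι) {g : Ω → ℝ} (hg : Integrable g μ) :
    (fun p => (μ.real (ι ⁻¹' {ι p}))⁻¹ * ∫ q in ι ⁻¹' {ι p}, g q ∂μ) =ᵐ[μ]
      μ[g | mκ.comap ι] := by
  classical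
  set h : κ → ℝ := fun k => (μ.real (ι ⁻¹' {k}))⁻¹ * ∫ q in ι ⁻¹' {k}, g q ∂μ with hh
  have hfib : ∀ k, MeasurableSet (ι ⁻¹' {k}) := fun k => hι (measurableSet_singleton k)
  have hmeas : Measurable (h ∘ ι) := (measurable_of_finite h).comp hι
  have hint : Integrable (h ∘ ι) μ := by
    refine Integrable.of_bound hmeas.aestronglyMeasurable (∑ k, ‖h k‖) ?_
    exact ae_of_all _ fun p =>
      Finset.single_le_sum (f := fun k => ‖h k‖) (fun _ _ => norm_nonneg _) (Finset.mem_univ (ι p))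
  refine ae_eq_condExp_of_forall_setIntegral_eq (g := h ∘ ι) hι.comap_le hg
    (fun s _ _ => hint.integrableOn) ?_ ?_
  · rintro s ⟨T, -, rfl⟩ -
    have hT : ι ⁻¹' T = ⋃ k ∈ T.toFinset, ι ⁻¹' {k} := by ext; simp
    have hdisj : Set.Pairwise (↑T.toFinset) (Function.onFun Disjoint fun k => ι ⁻¹' {k}) :=
      fun a _ b _ hab => Disjoint.preimage _ (by simpa using hab)
    rw [hT, integral_biUnion_finset _ (fun k _ => hfib k) hdisj fun k _ => hint.integrableOn,
      integral_biUnion_finset _ (fun k _ => hfib k) hdisj fun k _ => hg.integrableOn]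
    refine Finset.sum_congr rfl fun k _ => ?_
    have hconst : ∫ p in ι ⁻¹' {k}, (h ∘ ι) p ∂μ = ∫ p in ι ⁻¹' {k}, h k ∂μ :=
      setIntegral_congr_fun (hfib k) fun p hp => by simp [Set.mem_singleton_iff.1 hp]
    rw [hconst, setIntegral_const, smul_eq_mul, hh]
    rcases eq_or_ne (μ.real (ι ⁻¹' {k})) 0 with h0 | h0
    · have : μ (ι ⁻¹' {k}) = 0 := (measureReal_eq_zero_iff).1 h0
      rw [h0, Measure.restrict_eq_zero.2 this]
      simp
    · rw [mul_inv_cancel_left₀ h0]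
  · exact ((measurable_of_finite h).comp
      (comap_measurable ι)).stronglyMeasurable.aestronglyMeasurable

/-- The index of the class of a finite partition containing a given point. -/
def FinPartition.index (P : FinPartition) (t : unitInterval) : Fin P.n :=
  (Set.mem_iUnion.1 (P.covers ▸ Set.mem_univ t)).choose

theorem FinPartition.mem_part_iff (P : FinPartition) {t : unitInterval} {i : Fin P.n} :
    t ∈ P.part i ↔ P.index t = i := by
  have h : t ∈ P.part (P.index t) :=
    (Set.mem_iUnion.1 (P.covers ▸ Set.mem_univ t)).choose_spec
  refine ⟨fun hi => ?_, fun hi => hi ▸ h⟩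
  by_contra hne
  exact Set.disjoint_left.1 (P.disjoint _ _ hne) h hi

theorem FinPartition.measurable_index (P : FinPartition) : Measurable P.index := by
  refine measurable_to_countable' fun i => ?_
  have : P.index ⁻¹' {i} = P.part i := by ext t; simp [P.mem_part_iff]
  exact this ▸ P.measurableSet i

/-- The pair of indices of the cell of `P × P` containing a given point of the square. -/
def FinPartition.index₂ (P : FinPartition) (p : Sq) : Fin P.n × Fin P.n :=
  (P.index p.1, P.index p.2)

theorem FinPartition.measurable_index₂ (P : FinPartition) : Measurable P.index₂ :=
  (P.measurable_index.comp measurable_fst).prodMk (P.measurable_index.comp measurable_snd)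

/-- The cell of `P × P` containing a given point of the square. -/
def FinPartition.cell (P : FinPartition) (p : Sq) : Set Sq :=
  P.part (P.index p.1) ×ˢ P.part (P.index p.2)

theorem FinPartition.preimage_index₂ (P : FinPartition) (p : Sq) :
    P.index₂ ⁻¹' {P.index₂ p} = P.cell p := by
  ext q
  simp [index₂, cell, P.mem_part_iff]

theorem FinPartition.volume_cell (P : FinPartition) (p : Sq) :
    volume (P.cell p) = volume (P.part (P.index p.1)) * volume (P.part (P.index p.2)) := by
  rw [cell, Measure.volume_eq_prod, Measure.prod_prod]

theorem FinPartition.comap_index₂_le {P Q : FinPartition} (h : P.Refines Q) :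
    MeasurableSpace.comap Q.index₂ inferInstance ≤
      MeasurableSpace.comap P.index₂ inferInstance := by
  choose j hj using h
  have hidx : ∀ t, Q.index t = j (P.index t) := fun t =>
    Q.mem_part_iff.1 (hj _ (P.mem_part_iff.2 rfl))
  have : Q.index₂ = (fun k => (j k.1, j k.2)) ∘ P.index₂ := by
    funext p
    simp [index₂, hidx]
  rw [this, ← MeasurableSpace.comap_comp]
  exact MeasurableSpace.comap_mono (measurable_of_finite _).comap_le

/-- The filtration of the square generated by a refining sequence of partitions. -/
def partitionFiltration (Pn : ℕ → FinPartition) (href : ∀ n, (Pn (n + 1)).Refines (Pn n)) :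
    Filtration ℕ (inferInstance : MeasurableSpace Sq) where
  seq n := MeasurableSpace.comap (Pn n).index₂ inferInstance
  mono' := monotone_nat_of_le_succ fun n => FinPartition.comap_index₂_le (href n)
  le' n := (Pn n).measurable_index₂.comap_le

theorem iSup_partitionFiltration (Pn : ℕ → FinPartition)
    (href : ∀ n, (Pn (n + 1)).Refines (Pn n))
    (hgen : MeasurableSpace.generateFrom
        {S : Set unitInterval | ∃ n i, S = (Pn n).part i} =
      (inferInstance : MeasurableSpace unitInterval)) :
    ⨆ n, partitionFiltration Pn href n = (inferInstance : MeasurableSpace Sq) := by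
  change _ = Subtype.instMeasurableSpace at hgen
  refine le_antisymm (iSup_le fun n => (partitionFiltration Pn href).le n) (sup_le ?_ ?_)
  all_goals
    refine (MeasurableSpace.comap_mono hgen.ge).trans ?_
    rw [MeasurableSpace.comap_generateFrom]
    refine MeasurableSpace.generateFrom_le ?_
    rintro _ ⟨_, ⟨n, i, rfl⟩, rfl⟩
    refine le_iSup (fun n => (partitionFiltration Pn href n : MeasurableSpace Sq)) n _ ?_
  · refine ⟨{k | k.1 = i}, Set.Finite.measurableSet (Set.toFinite _), ?_⟩
    ext p
    simp [FinPartition.index₂, FinPartition.mem_part_iff]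
  · refine ⟨{k | k.2 = i}, Set.Finite.measurableSet (Set.toFinite _), ?_⟩
    ext p
    simp [FinPartition.index₂, FinPartition.mem_part_iff]

theorem tendsto_ae_cellAverage (Pn : ℕ → FinPartition)
    (href : ∀ n, (Pn (n + 1)).Refines (Pn n))
    (hgen : MeasurableSpace.generateFrom
        {S : Set unitInterval | ∃ n i, S = (Pn n).part i} =
      (inferInstance : MeasurableSpace unitInterval))
    {g : Sq → ℝ} (hgm : Measurable g) (hg : Integrable g) :
    ∀ᵐ p, Tendsto (fun n => (volume.real ((Pn n).cell p))⁻¹ * ∫ q in (Pn n).cell p, g q)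
      atTop (𝓝 (g p)) := by
  have hlim := tendsto_ae_condExp (μ := volume) (ℱ := partitionFiltration Pn href) g
  rw [iSup_partitionFiltration Pn href hgen,
    condExp_of_stronglyMeasurable le_rfl hgm.stronglyMeasurable hg] at hlim
  have hav := ae_all_iff.2 fun n =>
    condExp_comap_ae_eq_setAverage (Pn n).measurable_index₂ hg
  filter_upwards [hlim, hav] with p hp hpav
  refine hp.congr fun n => ?_
  rw [← (Pn n).preimage_index₂]
  exact (hpav n).symm

theorem isLUB_posPart {X : Type*} [mX : MeasurableSpace X] (s : SignedMeasure X)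
    {S : Set (Set X)} (hS : IsSetAlgebra S) (hgen : mX = MeasurableSpace.generateFrom S)
    {A : Set X} (hA : MeasurableSet A) :
    IsLUB (Set.range fun B : S => s (B.1 ∩ A)) (s.toJordanDecomposition.posPart.real A) := by
  have hSm : ∀ B ∈ S, MeasurableSet B := fun B hB =>
    hgen ▸ MeasurableSpace.measurableSet_generateFrom hB
  obtain ⟨N, hN, hpos, hneg⟩ := s.toJordanDecomposition.mutuallySingular
  have hs : ∀ B, MeasurableSet B → s B = _ := fun B hB =>
    s.apply_eq_posPart_real_sub_negPart_real hB
  set μ := s.toJordanDecomposition.posPart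
  set ν := s.toJordanDecomposition.negPart
  constructor
  · rintro _ ⟨B, rfl⟩
    have h1 : μ.real (B.1 ∩ A) ≤ μ.real A := measureReal_mono Set.inter_subset_right
    have h2 : 0 ≤ ν.real (B.1 ∩ A) := measureReal_nonneg
    simp only [hs _ ((hSm _ B.2).inter hA)]
    linarith
  · intro b hb
    refine le_of_forall_pos_le_add fun ε hε => ?_
    obtain ⟨B, hB, hBε⟩ := (Measure.MeasureDense.of_generateFrom_isSetAlgebra_finite
      (μ := μ + ν) hS hgen).approx Nᶜ hN.compl (measure_ne_top _ _) ε hε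
    have hb' : s (B ∩ A) ≤ b := hb ⟨⟨B, hB⟩, rfl⟩
    rw [hs _ ((hSm _ hB).inter hA)] at hb'
    have hD : μ.real (symmDiff Nᶜ B) + ν.real (symmDiff Nᶜ B) < ε := by
      rw [← measureReal_add_apply]
      exact (ENNReal.lt_ofReal_iff_toReal_lt (measure_ne_top _ _)).1 hBε
    have h1 : μ.real A ≤ μ.real (B ∩ A) + μ.real (symmDiff Nᶜ B) := by
      have h0 : μ.real N = 0 := by simp [measureReal_def, hpos]
      have hsub : A ⊆ (B ∩ A) ∪ symmDiff Nᶜ B ∪ N := by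
        intro x hx
        by_cases hxN : x ∈ N <;> by_cases hxB : x ∈ B <;> simp [Set.mem_symmDiff, *]
      have := (measureReal_mono (μ := μ) hsub).trans (measureReal_union_le _ _)
      have := measureReal_union_le (μ := μ) (B ∩ A) (symmDiff Nᶜ B)
      linarith
    have h2 : ν.real (B ∩ A) ≤ ν.real (symmDiff Nᶜ B) := by
      have h0 : ν.real Nᶜ = 0 := by simp [measureReal_def, hneg]
      have hsub : B ∩ A ⊆ symmDiff Nᶜ B ∪ Nᶜ := by
        rintro x ⟨hxB, -⟩
        by_cases hxN : x ∈ N <;> simp [Set.mem_symmDiff, *]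
      have := (measureReal_mono (μ := ν) hsub).trans (measureReal_union_le _ _)
      linarith
    linarith

theorem measurable_posPart {Ω X : Type*} [MeasurableSpace Ω] [MeasurableSpace X]
    [MeasurableSpace.CountablyGenerated X] {W : Ω → SignedMeasure X}
    (hW : ∀ A, MeasurableSet A → Measurable fun p => W p A) :
    Measurable fun p => (W p).toJordanDecomposition.posPart := by
  set S := generateSetAlgebra (MeasurableSpace.countableGeneratingSet X)
  have hgen : ‹MeasurableSpace X› = MeasurableSpace.generateFrom S := by
    rw [generateFrom_generateSetAlgebra_eq, MeasurableSpace.generateFrom_countableGeneratingSet]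
  have hcount : Countable S :=
    (countable_generateSetAlgebra (MeasurableSpace.countable_countableGeneratingSet)).to_subtype
  refine Measure.measurable_of_measurable_coe _ fun A hA => ?_
  have h : Measurable fun p => (W p).toJordanDecomposition.posPart.real A :=
    Measurable.isLUB (f := fun (B : S) p => W p (B.1 ∩ A))
      (fun B => hW _ ((hgen ▸ MeasurableSpace.measurableSet_generateFrom B.2).inter hA))
      fun p => isLUB_posPart (W p) isSetAlgebra_generateSetAlgebra hgen hA
  simpa using h.ennreal_ofReal

theorem measurable_negPart {Ω X : Type*} [MeasurableSpace Ω] [MeasurableSpace X]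
    [MeasurableSpace.CountablyGenerated X] {W : Ω → SignedMeasure X}
    (hW : ∀ A, MeasurableSet A → Measurable fun p => W p A) :
    Measurable fun p => (W p).toJordanDecomposition.negPart := by
  have h := measurable_posPart (W := fun p => -W p) fun A hA => (hW A hA).neg
  simpa [SignedMeasure.toJordanDecomposition_neg] using h

theorem tendsto_finiteMeasure_of_isPiSystem {ι X : Type*} [MeasurableSpace X] [TopologicalSpace X]
    [SecondCountableTopology X] [OpensMeasurableSpace X] {S : Set (Set X)} (hS : IsPiSystem S)
    {μ : ι → FiniteMeasure X} {ν : FiniteMeasure X} {l : Filter ι} [l.IsCountablyGenerated]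
    (hmeas : ∀ s ∈ S, MeasurableSet s) (huniv : Set.univ ∈ S)
    (hnhds : ∀ u : Set X, IsOpen u → ∀ x ∈ u, ∃ s ∈ S, s ∈ 𝓝 x ∧ s ⊆ u)
    (hlim : ∀ s ∈ S, Tendsto (fun i => μ i s) l (𝓝 (ν s))) :
    Tendsto μ l (𝓝 ν) := by
  have hmass : Tendsto (fun i => (μ i).mass) l (𝓝 ν.mass) := hlim _ huniv
  rcases eq_or_ne ν 0 with rfl | hν
  · exact FiniteMeasure.tendsto_zero_of_tendsto_zero_mass (by simpa using hmass)
  have : Nonempty X := by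
    by_contra hX
    rw [not_nonempty_iff] at hX
    exact hν (Subtype.ext (Measure.eq_zero_of_isEmpty _))
  have hνm : ν.mass ≠ 0 := ν.mass_nonzero_iff.2 hν
  refine FiniteMeasure.tendsto_of_tendsto_normalize_testAgainstNN_of_tendsto_mass
    (hS.tendsto_probabilityMeasure_of_tendsto_of_mem hmeas hnhds fun s hs => ?_) hmass
  rw [ν.normalize_eq_of_nonzero hν]
  refine ((hmass.inv₀ hνm).mul (hlim s hs)).congr' ?_
  filter_upwards [hmass.eventually_ne hνm] with i hi
  rw [(μ i).normalize_eq_of_nonzero ((μ i).mass_nonzero_iff.1 hi)]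

section CellMean

variable {X : Type*} [MeasurableSpace X]

/-- The mean of a measure-valued kernel over the cell of `P × P` containing a given point. -/
def cellMean (M : Sq → Measure X) (P : FinPartition) (p : Sq) : Measure X :=
  ENNReal.ofReal (volume.real (P.cell p))⁻¹ • kernelInt M (P.cell p)

theorem FinPartition.measurableSet_cell (P : FinPartition) (p : Sq) : MeasurableSet (P.cell p) :=
  (P.measurableSet _).prod (P.measurableSet _)

theorem kernelInt_apply {M : Sq → Measure X} (hM : Measurable M) (D : Set Sq) {A : Set X}
    (hA : MeasurableSet A) : kernelInt M D A = ∫⁻ q in D, M q A :=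
  Measure.bind_apply hA hM.aemeasurable

theorem isFiniteMeasure_kernelInt {M : Sq → Measure X} (hM : Measurable M) {C : ℝ≥0∞}
    (hC : C ≠ ⊤) (hMC : ∀ᵐ p, M p Set.univ ≤ C) (D : Set Sq) :
    IsFiniteMeasure (kernelInt M D) := by
  refine ⟨?_⟩
  rw [kernelInt_apply hM D MeasurableSet.univ]
  calc ∫⁻ q in D, M q Set.univ ≤ ∫⁻ _ in D, C := lintegral_mono_ae (ae_restrict_of_ae hMC)
    _ = C * volume D := by simp
    _ < ⊤ := ENNReal.mul_lt_top hC.lt_top (measure_lt_top _ _)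

theorem isFiniteMeasure_cellMean {M : Sq → Measure X} (hM : Measurable M) {C : ℝ≥0∞}
    (hC : C ≠ ⊤) (hMC : ∀ᵐ p, M p Set.univ ≤ C) (P : FinPartition) (p : Sq) :
    IsFiniteMeasure (cellMean M P p) := by
  have := isFiniteMeasure_kernelInt hM hC hMC (P.cell p)
  exact Measure.smul_finite _ ENNReal.ofReal_ne_top

theorem integrable_real_apply {M : Sq → Measure X} [∀ p, IsFiniteMeasure (M p)]
    (hM : Measurable M) {C : ℝ≥0∞} (hC : C ≠ ⊤) (hMC : ∀ᵐ p, M p Set.univ ≤ C) {A : Set X}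
    (hA : MeasurableSet A) : Integrable fun q => (M q).real A := by
  refine Integrable.of_bound (C := C.toReal)
    ((Measure.measurable_coe hA).comp hM).ennreal_toReal.aestronglyMeasurable ?_
  filter_upwards [hMC] with q hq
  rw [Real.norm_of_nonneg measureReal_nonneg]
  exact ENNReal.toReal_mono hC ((measure_mono (Set.subset_univ A)).trans hq)

theorem cellMean_real_apply {M : Sq → Measure X} [∀ p, IsFiniteMeasure (M p)]
    (hM : Measurable M) (P : FinPartition) (p : Sq) {A : Set X} (hA : MeasurableSet A) :
    (cellMean M P p).real A = (volume.real (P.cell p))⁻¹ * ∫ q in P.cell p, (M q).real A := by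
  have hr : 0 ≤ (volume.real (P.cell p))⁻¹ := inv_nonneg.2 measureReal_nonneg
  have : ∫ q in P.cell p, (M q).real A = (∫⁻ q in P.cell p, M q A).toReal :=
    integral_toReal ((Measure.measurable_coe hA).comp hM).aemeasurable
      (ae_of_all _ fun q => measure_lt_top _ _)
  rw [this, measureReal_def, cellMean, Measure.smul_apply, kernelInt_apply hM _ hA, smul_eq_mul,
    ENNReal.toReal_mul, ENNReal.toReal_ofReal hr]

theorem cellMean_weakTendsto [TopologicalSpace X] [SecondCountableTopology X] [BorelSpace X]
    {M : Sq → Measure X} [∀ p, IsFiniteMeasure (M p)] (hM : Measurable M) {C : ℝ≥0∞}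
    (hC : C ≠ ⊤) (hMC : ∀ᵐ p, M p Set.univ ≤ C) (Pn : ℕ → FinPartition)
    (href : ∀ n, (Pn (n + 1)).Refines (Pn n))
    (hgen : MeasurableSpace.generateFrom
        {S : Set unitInterval | ∃ n i, S = (Pn n).part i} =
      (inferInstance : MeasurableSpace unitInterval)) :
    ∀ᵐ p, WeakTendsto (fun n => cellMean M (Pn n) p) (M p) := by
  set S := generateSetAlgebra (TopologicalSpace.countableBasis X)
  have hSalg : IsSetAlgebra S := isSetAlgebra_generateSetAlgebra
  have hSm : ∀ A ∈ S, MeasurableSet A := by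
    have h := MeasurableSpace.generateFrom_le (s := TopologicalSpace.countableBasis X)
      fun t ht => (TopologicalSpace.isOpen_of_mem_countableBasis ht).measurableSet
    rw [← generateFrom_generateSetAlgebra_eq] at h
    exact fun A hA => h _ (MeasurableSpace.measurableSet_generateFrom hA)
  have hScount : S.Countable :=
    countable_generateSetAlgebra (TopologicalSpace.countable_countableBasis X)
  have hlim : ∀ᵐ p, ∀ A ∈ S,
      Tendsto (fun n => (cellMean M (Pn n) p).real A) atTop (𝓝 ((M p).real A)) := by
    refine (ae_ball_iff hScount).2 fun A hA => ?_
    filter_upwards [tendsto_ae_cellAverage Pn href hgen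
      ((Measure.measurable_coe (hSm A hA)).comp hM).ennreal_toReal
      (integrable_real_apply hM hC hMC (hSm A hA))] with p hp
    exact hp.congr fun n => (cellMean_real_apply hM (Pn n) p (hSm A hA)).symm
  filter_upwards [hlim] with p hp
  let μ : ℕ → FiniteMeasure X := fun n =>
    ⟨cellMean M (Pn n) p, isFiniteMeasure_cellMean hM hC hMC (Pn n) p⟩
  let ν : FiniteMeasure X := ⟨M p, inferInstance⟩
  have hμν : Tendsto μ atTop (𝓝 ν) := by
    refine tendsto_finiteMeasure_of_isPiSystem (S := S)
      (fun s hs t ht _ => hSalg.inter_mem hs ht) hSm hSalg.univ_mem ?_ ?_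
    · intro u hu x hx
      obtain ⟨s, hs, hxs, hsu⟩ :=
        (TopologicalSpace.isBasis_countableBasis X).exists_subset_of_mem_open hx hu
      exact ⟨s, self_subset_generateSetAlgebra hs,
        (TopologicalSpace.isOpen_of_mem_countableBasis hs).mem_nhds hxs, hsu⟩
    · exact fun A hA => NNReal.tendsto_coe.1 (hp A hA)
  exact FiniteMeasure.tendsto_iff_forall_integral_tendsto.1 hμν

end CellMean

theorem TVnorm_toSignedMeasure_sub_le {X : Type*} [MeasurableSpace X] (μ ν : Measure X)
    [IsFiniteMeasure μ] [IsFiniteMeasure ν] :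
    TVnorm (μ.toSignedMeasure - ν.toSignedMeasure) ≤ μ Set.univ + ν Set.univ := by
  rw [TVnorm, SignedMeasure.totalVariation, Measure.toJordanDecomposition_toSignedMeasure_sub]
  exact add_le_add (Measure.sub_le _) (Measure.sub_le _)

theorem sint_toSignedMeasure_sub {X : Type*} [MeasurableSpace X] [TopologicalSpace X]
    [OpensMeasurableSpace X] (f : BoundedContinuousFunction X ℝ) (μ ν : Measure X)
    [IsFiniteMeasure μ] [IsFiniteMeasure ν] :
    sint f (μ.toSignedMeasure - ν.toSignedMeasure) = ∫ x, f x ∂μ - ∫ x, f x ∂ν := by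
  set s := μ.toSignedMeasure - ν.toSignedMeasure with hs
  set j := s.toJordanDecomposition with hj
  have h : j.posPart + ν = j.negPart + μ := by
    have h' : j.posPart.toSignedMeasure - j.negPart.toSignedMeasure = s :=
      s.toSignedMeasure_toJordanDecomposition
    refine Measure.toSignedMeasure_eq_toSignedMeasure_iff.1 ?_
    rw [Measure.toSignedMeasure_add, Measure.toSignedMeasure_add, ← sub_eq_zero]
    rw [hs, ← sub_eq_zero] at h'
    rw [← h']
    abel
  have hint := congrArg (fun ρ : Measure X => ∫ x, f x ∂ρ) h
  beta_reduce at hint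
  rw [integral_add_measure (f.integrable _) (f.integrable _),
    integral_add_measure (f.integrable _) (f.integrable _)] at hint
  rw [sint]
  linarith

theorem steppingS_eq_smul {X : Type*} [MeasurableSpace X] (W : Sq → SignedMeasure X)
    (P : FinPartition) (p : Sq) :
    steppingS W P p = (volume.real (P.cell p))⁻¹ • skernelInt W (P.cell p) := by
  have hmem : ∀ i j, p ∈ P.part i ×ˢ P.part j ↔ P.index p.1 = i ∧ P.index p.2 = j := fun i j => by
    rw [Set.mem_prod, P.mem_part_iff, P.mem_part_iff]
  rw [steppingS, Finset.sum_eq_single (P.index p.1), Finset.sum_eq_single (P.index p.2)]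
  · rw [Set.indicator_of_mem ((hmem _ _).2 ⟨rfl, rfl⟩), measureReal_def, P.volume_cell,
      ENNReal.toReal_mul]
    rfl
  · exact fun j _ hj => Set.indicator_of_notMem (fun h => hj ((hmem _ _).1 h).2.symm) _
  · simp
  · exact fun i _ hi => Finset.sum_eq_zero fun j _ =>
      Set.indicator_of_notMem (fun h => hi ((hmem _ _).1 h).1.symm) _
  · simp

theorem ae_TVnorm_le_TVbound {X : Type*} [MeasurableSpace X] (W : Sq → SignedMeasure X) :
    ∀ᵐ p, TVnorm (W p) ≤ TVbound W :=
  ae_le_essSup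

theorem ae_posPart_le_TVbound {X : Type*} [MeasurableSpace X] (W : Sq → SignedMeasure X) :
    ∀ᵐ p, (W p).toJordanDecomposition.posPart Set.univ ≤ TVbound W := by
  filter_upwards [ae_TVnorm_le_TVbound W] with p hp
  exact le_self_add.trans hp

theorem ae_negPart_le_TVbound {X : Type*} [MeasurableSpace X] (W : Sq → SignedMeasure X) :
    ∀ᵐ p, (W p).toJordanDecomposition.negPart Set.univ ≤ TVbound W := by
  filter_upwards [ae_TVnorm_le_TVbound W] with p hp
  exact le_add_self.trans hp

section SignedKernel

variable {X : Type*} [MeasurableSpace X] [MeasurableSpace.CountablyGenerated X]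
  {W : Sq → SignedMeasure X}

theorem IsSignedKernel.steppingS_eq (hW : IsSignedKernel W) (P : FinPartition) (p : Sq) :
    ∃ (_ : IsFiniteMeasure (cellMean (fun q => (W q).toJordanDecomposition.posPart) P p))
      (_ : IsFiniteMeasure (cellMean (fun q => (W q).toJordanDecomposition.negPart) P p)),
      steppingS W P p =
        (cellMean (fun q => (W q).toJordanDecomposition.posPart) P p).toSignedMeasure -
        (cellMean (fun q => (W q).toJordanDecomposition.negPart) P p).toSignedMeasure := by
  have h1 := isFiniteMeasure_kernelInt (measurable_posPart hW.1) hW.2.ne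
    (ae_posPart_le_TVbound W) (P.cell p)
  have h2 := isFiniteMeasure_kernelInt (measurable_negPart hW.1) hW.2.ne
    (ae_negPart_le_TVbound W) (P.cell p)
  have hr : 0 ≤ (volume.real (P.cell p))⁻¹ := inv_nonneg.2 measureReal_nonneg
  refine ⟨isFiniteMeasure_cellMean (measurable_posPart hW.1) hW.2.ne (ae_posPart_le_TVbound W) P p,
    isFiniteMeasure_cellMean (measurable_negPart hW.1) hW.2.ne (ae_negPart_le_TVbound W) P p, ?_⟩
  have hsk : skernelInt W (P.cell p) =
      (kernelInt (fun q => (W q).toJordanDecomposition.posPart) (P.cell p)).toSignedMeasure -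
      (kernelInt (fun q => (W q).toJordanDecomposition.negPart) (P.cell p)).toSignedMeasure := by
    rw [skernelInt, toSigned, toSigned]
    exact congrArg₂ _ (dif_pos h1) (dif_pos h2)
  rw [steppingS_eq_smul, hsk]
  ext A hA
  simp [cellMean, Measure.toSignedMeasure_apply_measurable hA, measureReal_def, mul_sub]

theorem IsSignedKernel.TVnorm_steppingS_le (hW : IsSignedKernel W) (P : FinPartition) (p : Sq) :
    TVnorm (steppingS W P p) ≤ TVbound W := by
  obtain ⟨h1, h2, h⟩ := hW.steppingS_eq P p
  have hpos := measurable_posPart hW.1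
  have hneg := measurable_negPart hW.1
  set r := ENNReal.ofReal (volume.real (P.cell p))⁻¹ with hr
  rw [h]
  refine (TVnorm_toSignedMeasure_sub_le _ _).trans ?_
  calc _ = r * ∫⁻ q in P.cell p, TVnorm (W q) := by
        simp only [cellMean, Measure.smul_apply, smul_eq_mul,
          kernelInt_apply hpos _ MeasurableSet.univ, kernelInt_apply hneg _ MeasurableSet.univ]
        rw [← mul_add]
        exact congrArg (r * ·) (lintegral_add_left
          ((Measure.measurable_coe MeasurableSet.univ).comp hpos) _).symm
    _ ≤ r * ∫⁻ _ in P.cell p, TVbound W := by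
        refine mul_le_mul_right (lintegral_mono_ae ?_) _
        exact ae_restrict_of_ae (ae_TVnorm_le_TVbound W)
    _ = r * volume (P.cell p) * TVbound W := by
        rw [setLIntegral_const, mul_assoc, mul_comm (TVbound W)]
    _ ≤ 1 * TVbound W := by
        gcongr
        rw [hr, ← ofReal_measureReal, ← ENNReal.ofReal_mul (inv_nonneg.2 measureReal_nonneg)]
        exact ENNReal.ofReal_le_one.2 inv_mul_le_one
    _ = TVbound W := one_mul _

end SignedKernel

/-- **Approximation by steppings.**
Let `W` be a signed measure-valued kernel and let `(𝒫_n)` be a sequence of finite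
measurable partitions of `[0,1]` such that `𝒫_{n+1}` refines `𝒫_n` for every `n` and
the collection of all classes of the partitions generates the Borel σ-field of
`[0,1]`.  Then the steppings `W_{𝒫_n}` satisfy `‖W_{𝒫_n}‖∞ ≤ ‖W‖∞` for every `n`,
and for a.e. `(x,y) ∈ [0,1]²` the sequence `W_{𝒫_n}(x,y;·)` converges weakly to
`W(x,y;·)`. -/
theorem approximation_by_steppings
    {Z : Type*} [MeasurableSpace Z] [TopologicalSpace Z] [PolishSpace Z] [BorelSpace Z]
    (W : Sq → SignedMeasure Z) (hW : IsSignedKernel W)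
    (Pn : ℕ → FinPartition)
    (href : ∀ n, (Pn (n + 1)).Refines (Pn n))
    (hgen : MeasurableSpace.generateFrom
        {S : Set unitInterval | ∃ n i, S = (Pn n).part i} =
      (inferInstance : MeasurableSpace unitInterval)) :
    (∀ n, TVbound (steppingS W (Pn n)) ≤ TVbound W) ∧
    (∀ᵐ p ∂(volume : Measure Sq),
      WeakTendstoS (fun n => steppingS W (Pn n) p) (W p)) := by
  refine ⟨fun n => essSup_le_of_ae_le _ (ae_of_all _ (hW.TVnorm_steppingS_le (Pn n))), ?_⟩
  filter_upwards [cellMean_weakTendsto (measurable_posPart hW.1) hW.2.ne (ae_posPart_le_TVbound W)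
      Pn href hgen,
    cellMean_weakTendsto (measurable_negPart hW.1) hW.2.ne (ae_negPart_le_TVbound W)
      Pn href hgen] with p hpos hneg f
  refine ((hpos f).sub (hneg f)).congr fun n => ?_
  obtain ⟨h1, h2, h⟩ := hW.steppingS_eq (Pn n) p
  beta_reduce
  rw [h, sint_toSignedMeasure_sub]

end PG
end
end

section
/- Completeness of d_F characterizes compactness: let Z be a Polish space and let F be a convergence determining sequence on Z. Let d_F be the distance on the set ℳ₁(Z) of probability measures induced by the norm ‖·‖_F, i.e. d_F(μ,ν) = ‖μ−ν‖_F. Then d_F is a complete metric on ℳ₁(Z) if and only if ℳ₁(Z) is compact, which holds if and only if Z is compact. -/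
open MeasureTheory Filter Topology
open scoped ENNReal NNReal

noncomputable section

namespace PG

variable {Z : Type*} [MeasurableSpace Z] [TopologicalSpace Z]

/-- The distance `d_F(μ,ν) = ‖μ − ν‖_F = Σ_k 2^{-k} |μ(f_k) − ν(f_k)|` on
probability measures. -/
def dFP {Z : Type*} [MeasurableSpace Z] [TopologicalSpace Z]
    (F : ℕ → BoundedContinuousFunction Z ℝ) (μ ν : ProbabilityMeasure Z) : ℝ :=
  ∑' k : ℕ, (1/2 : ℝ) ^ k *
    |∫ x, F k x ∂(μ : Measure Z) - ∫ x, F k x ∂(ν : Measure Z)|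

section Completeness

variable {F : ℕ → BoundedContinuousFunction Z ℝ}

lemma integral_mem_Icc_of_forall_mem_Icc [OpensMeasurableSpace Z]
    {f : BoundedContinuousFunction Z ℝ} (hf : ∀ x, f x ∈ Set.Icc (0 : ℝ) 1)
    (μ : ProbabilityMeasure Z) : ∫ x, f x ∂(μ : Measure Z) ∈ Set.Icc (0 : ℝ) 1 := by
  refine ⟨integral_nonneg fun x => (hf x).1, ?_⟩
  calc ∫ x, f x ∂(μ : Measure Z) ≤ ∫ _, (1 : ℝ) ∂(μ : Measure Z) :=
        integral_mono (f.integrable _) (integrable_const _) fun x => (hf x).2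
    _ = 1 := by simp

lemma dFP_term_le [OpensMeasurableSpace Z] (hF : ∀ k x, F k x ∈ Set.Icc (0 : ℝ) 1)
    (μ ν : ProbabilityMeasure Z) (k : ℕ) :
    (1/2 : ℝ) ^ k * |∫ x, F k x ∂(μ : Measure Z) - ∫ x, F k x ∂(ν : Measure Z)|
      ≤ (1/2 : ℝ) ^ k := by
  have hμ := integral_mem_Icc_of_forall_mem_Icc (hF k) μ
  have hν := integral_mem_Icc_of_forall_mem_Icc (hF k) ν
  refine mul_le_of_le_one_right (by positivity) (abs_le.2 ⟨?_, ?_⟩) <;>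
    linarith [hμ.1, hμ.2, hν.1, hν.2]

lemma dFP_nonneg (F : ℕ → BoundedContinuousFunction Z ℝ) (μ ν : ProbabilityMeasure Z) :
    0 ≤ dFP F μ ν :=
  tsum_nonneg fun _ => by positivity

lemma abs_integral_sub_le_dFP [OpensMeasurableSpace Z]
    (hF : ∀ k x, F k x ∈ Set.Icc (0 : ℝ) 1) (μ ν : ProbabilityMeasure Z) (k : ℕ) :
    |∫ x, F k x ∂(μ : Measure Z) - ∫ x, F k x ∂(ν : Measure Z)| ≤ 2 ^ k * dFP F μ ν := by
  have hs : Summable fun k : ℕ => (1/2 : ℝ) ^ k *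
      |∫ x, F k x ∂(μ : Measure Z) - ∫ x, F k x ∂(ν : Measure Z)| :=
    summable_geometric_two.of_nonneg_of_le (fun _ => by positivity) (dFP_term_le hF μ ν)
  have h := mul_le_mul_of_nonneg_left (hs.le_tsum k fun _ _ => by positivity)
    (by positivity : (0 : ℝ) ≤ 2 ^ k)
  rwa [← mul_assoc, ← mul_pow, mul_one_div_cancel two_ne_zero, one_pow, one_mul] at h

/-- `d_F` tends to zero along two families of probability measures if and only if the moments
against each `F k` become asymptotically equal. -/
lemma tendsto_dFP_zero_iff [OpensMeasurableSpace Z] (hF : ∀ k x, F k x ∈ Set.Icc (0 : ℝ) 1)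
    {ι : Type*} {l : Filter ι} {μ ν : ι → ProbabilityMeasure Z} :
    Tendsto (fun i => dFP F (μ i) (ν i)) l (𝓝 0) ↔
      ∀ k, Tendsto (fun i => ∫ x, F k x ∂(μ i : Measure Z) - ∫ x, F k x ∂(ν i : Measure Z))
        l (𝓝 0) := by
  refine ⟨fun h k => ?_, fun h => ?_⟩
  · exact squeeze_zero_norm (fun i => abs_integral_sub_le_dFP hF (μ i) (ν i) k)
      (by simpa using h.const_mul ((2 : ℝ) ^ k))
  · have := tendsto_tsum_of_dominated_convergence (𝓕 := l) (g := fun _ : ℕ => (0 : ℝ))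
      (f := fun i k => (1/2 : ℝ) ^ k *
        |∫ x, F k x ∂(μ i : Measure Z) - ∫ x, F k x ∂(ν i : Measure Z)|)
      summable_geometric_two (fun k => by simpa using (h k).abs.const_mul ((1/2 : ℝ) ^ k))
      (Eventually.of_forall fun i k => by
        rw [Real.norm_of_nonneg (by positivity)]
        exact dFP_term_le hF (μ i) (ν i) k)
    rwa [tsum_zero] at this

lemma cauchy_dFP_iff [OpensMeasurableSpace Z] (hF : ∀ k x, F k x ∈ Set.Icc (0 : ℝ) 1)
    {μ : ℕ → ProbabilityMeasure Z} :
    (∀ ε : ℝ, 0 < ε → ∃ N, ∀ m ≥ N, ∀ n ≥ N, dFP F (μ m) (μ n) < ε) ↔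
      ∀ k, CauchySeq fun n => ∫ x, F k x ∂(μ n : Measure Z) := by
  have h₁ : (∀ ε : ℝ, 0 < ε → ∃ N, ∀ m ≥ N, ∀ n ≥ N, dFP F (μ m) (μ n) < ε) ↔
      Tendsto (fun p : ℕ × ℕ => dFP F (μ p.1) (μ p.2)) atTop (𝓝 0) := by
    simp only [Metric.tendsto_nhds, Real.dist_0_eq_abs, abs_of_nonneg (dFP_nonneg F _ _),
      eventually_atTop_prod_self', gt_iff_lt]
  have h₂ : ∀ u : ℕ → ℝ, CauchySeq u ↔
      Tendsto (fun p : ℕ × ℕ => u p.1 - u p.2) atTop (𝓝 0) := fun u => by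
    rw [cauchySeq_iff_tendsto_dist_atTop_0,
      tendsto_zero_iff_abs_tendsto_zero fun p : ℕ × ℕ => u p.1 - u p.2]
    rfl
  rw [h₁, tendsto_dFP_zero_iff hF]
  exact forall_congr' fun k => (h₂ fun n => ∫ x, F k x ∂(μ n : Measure Z)).symm

lemma IsConvDet.tendsto_iff [OpensMeasurableSpace Z] (hF : IsConvDet F)
    {μ : ℕ → ProbabilityMeasure Z} {ν : ProbabilityMeasure Z} :
    Tendsto μ atTop (𝓝 ν) ↔
      ∀ k, Tendsto (fun n => ∫ x, F k x ∂(μ n : Measure Z)) atTop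
        (𝓝 (∫ x, F k x ∂(ν : Measure Z))) := by
  rw [ProbabilityMeasure.tendsto_iff_forall_integral_tendsto]
  exact ⟨fun h k => h (F k), hF.2.2 _ _ (fun _ => inferInstance) inferInstance⟩

lemma IsConvDet.tendsto_dFP_iff [OpensMeasurableSpace Z] (hF : IsConvDet F)
    {μ : ℕ → ProbabilityMeasure Z} {ν : ProbabilityMeasure Z} :
    Tendsto (fun n => dFP F (μ n) ν) atTop (𝓝 0) ↔ Tendsto μ atTop (𝓝 ν) := by
  rw [tendsto_dFP_zero_iff hF.2.1, hF.tendsto_iff]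
  exact forall_congr' fun k => tendsto_sub_nhds_zero_iff

/-- Every sequence of probability measures has a `d_F`-Cauchy subsequence. -/
lemma exists_strictMono_cauchy_dFP [OpensMeasurableSpace Z]
    (hF : ∀ k x, F k x ∈ Set.Icc (0 : ℝ) 1) (μ : ℕ → ProbabilityMeasure Z) :
    ∃ φ : ℕ → ℕ, StrictMono φ ∧
      ∀ ε : ℝ, 0 < ε → ∃ N, ∀ m ≥ N, ∀ n ≥ N, dFP F (μ (φ m)) (μ (φ n)) < ε := by
  obtain ⟨a, -, φ, hφ, ha⟩ :=
    (isCompact_univ_pi fun _ : ℕ => isCompact_Icc (a := (0 : ℝ)) (b := 1)).tendsto_subseq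
      (x := fun n k => ∫ x, F k x ∂(μ n : Measure Z))
      fun n k _ => integral_mem_Icc_of_forall_mem_Icc (hF k) (μ n)
  exact ⟨φ, hφ, (cauchy_dFP_iff hF).2 fun k => (tendsto_pi_nhds.1 ha k).cauchySeq⟩

lemma compactSpace_probabilityMeasure_iff [PolishSpace Z] [BorelSpace Z] :
    CompactSpace (ProbabilityMeasure Z) ↔ CompactSpace Z := by
  refine ⟨fun h => ?_, fun h => inferInstance⟩
  let := TopologicalSpace.upgradeIsCompletelyMetrizable Z
  have hT := isTightMeasureSet_of_isCompact_closure (S := (Set.univ : Set (ProbabilityMeasure Z)))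
    isClosed_closure.isCompact
  obtain ⟨K, hK, hKε⟩ := isTightMeasureSet_iff_exists_isCompact_measure_compl_le.1 hT (1 / 2)
    (by simp)
  have hKu : K = Set.univ := by
    by_contra hne
    obtain ⟨z, hz⟩ := (Set.ne_univ_iff_exists_notMem K).1 hne
    have := hKε _ ⟨diracProba z, Set.mem_univ _, rfl⟩
    simp only [diracProba, ProbabilityMeasure.coe_mk,
      Measure.dirac_apply_of_mem (Set.mem_compl hz)] at this
    norm_num at this
  exact ⟨hKu ▸ hK⟩

end Completeness

/-- **Completeness of `d_F` characterizes compactness.**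
Let `Z` be a Polish space and `F` a convergence determining sequence on `Z`, and let
`d_F` be the distance induced on `ℳ₁(Z)` by the norm `‖·‖_F`.  Then `d_F` is a
complete metric on `ℳ₁(Z)` if and only if `ℳ₁(Z)` is compact (for the weak topology),
which holds if and only if `Z` is compact. -/
theorem dF_complete_iff_compact
    {Z : Type*} [MeasurableSpace Z] [TopologicalSpace Z] [PolishSpace Z] [BorelSpace Z]
    (F : ℕ → BoundedContinuousFunction Z ℝ) (hF : IsConvDet F) :
    ((∀ μn : ℕ → ProbabilityMeasure Z,
        (∀ ε : ℝ, 0 < ε → ∃ N, ∀ m ≥ N, ∀ n ≥ N, dFP F (μn m) (μn n) < ε) →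
        ∃ μ : ProbabilityMeasure Z, Tendsto (fun n => dFP F (μn n) μ) atTop (𝓝 0)) ↔
      CompactSpace (ProbabilityMeasure Z)) ∧
    (CompactSpace (ProbabilityMeasure Z) ↔ CompactSpace Z) := by
  refine ⟨⟨fun hc => ?_, fun hc μ hμ => ?_⟩, compactSpace_probabilityMeasure_iff⟩
  · let := TopologicalSpace.metrizableSpaceMetric (ProbabilityMeasure Z)
    refine ⟨IsSeqCompact.isCompact fun μ _ => ?_⟩
    obtain ⟨φ, hφ, hcauchy⟩ := exists_strictMono_cauchy_dFP hF.2.1 μ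
    obtain ⟨ν, hν⟩ := hc (μ ∘ φ) hcauchy
    exact ⟨ν, Set.mem_univ _, φ, hφ, hF.tendsto_dFP_iff.1 hν⟩
  · let := TopologicalSpace.metrizableSpaceMetric (ProbabilityMeasure Z)
    obtain ⟨ν, φ, hφ, hν⟩ := CompactSpace.tendsto_subseq μ
    refine ⟨ν, hF.tendsto_dFP_iff.2 (hF.tendsto_iff.2 fun k => ?_)⟩
    exact tendsto_nhds_of_cauchySeq_of_subseq ((cauchy_dFP_iff hF.2.1).1 hμ k)
      hφ.tendsto_atTop (hF.tendsto_iff.1 hν k)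

end PG
end
end
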